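/- arXiv:2601.20054 — 2 statements merged into one kernel-verified Lean document; each statement's English description precedes it below -/
import Mathlib

section
/- Key potential-decrease inequality for an approximate best-response update (inequality (17) in the paper): Let Φ be a generalized potential for the game (Θ, J), let θ ∈ Θ, let i be a player such that {J i (Function.update θ i x') | x' ∈ Θ_i(θ)} is bounded below, let ε ≥ 0, and let x ∈ Θ_i(θ) be an ε-approximate best response of player i at θ. Then, for θ' := Function.update θ i x, one has Φ(θ) − Φ(θ') ≥ r_i(θ) − ε. -/
/-- Key potential-decrease inequality for an approximate best-response update
(inequality (17) in the paper): `Φ θ − Φ θ' ≥ r_i(θ) − ε` for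
`θ' = Function.update θ i x` with `x` an `ε`-approximate best response. -/
theorem potential_decrease_approx_best_response
    {ι : Type*} [DecidableEq ι] {α : ι → Type*}
    (Θ : Set (∀ i, α i)) (J : ι → (∀ i, α i) → ℝ) (Φ : (∀ i, α i) → ℝ)
    (hΦ : ∀ i : ι, ∀ θ ∈ Θ, ∀ θ' ∈ Θ,
      (∀ j, j ≠ i → θ' j = θ j) → J i θ' - J i θ = Φ θ' - Φ θ)
    (θ : ∀ i, α i) (hθ : θ ∈ Θ) (i : ι)
    (hbdd : BddBelow ((fun x' : α i => J i (Function.update θ i x')) ''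
      {x' : α i | Function.update θ i x' ∈ Θ}))
    (ε : ℝ) (hε : 0 ≤ ε) (x : α i)
    (hx : Function.update θ i x ∈ Θ)
    (habr : ∀ x' : α i, Function.update θ i x' ∈ Θ →
      J i (Function.update θ i x) ≤ J i (Function.update θ i x') + ε) :
    Φ θ - Φ (Function.update θ i x) ≥
      (J i θ - sInf ((fun x' : α i => J i (Function.update θ i x')) ''
        {x' : α i | Function.update θ i x' ∈ Θ})) - ε := by
  have hpot := hΦ i θ hθ _ hx fun j hj => Function.update_of_ne hj x θ
  have hinf : J i (Function.update θ i x) - ε ≤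
      sInf ((fun x' : α i => J i (Function.update θ i x')) ''
        {x' : α i | Function.update θ i x' ∈ Θ}) := by
    refine le_csInf ⟨_, x, hx, rfl⟩ ?_
    rintro _ ⟨x', hx', rfl⟩
    exact sub_le_iff_le_add.mpr (habr x' hx')
  linarith
end

section
/- ε̄-equilibrium under inexact iterative best response (Theorem 1): Let Φ be a generalized potential for the game (Θ, J) that is bounded below on Θ. Let ε̄ ≥ 0 and let (θ^m)_{m ≥ 0} be a sequence in Θ such that for every m there exist a player i_m and x_m ∈ Θ_{i_m}(θ^m) with θ^{m+1} = Function.update θ^m i_m x_m, where (i) x_m is an ε̄-approximate best response of player i_m at θ^m, (ii) the update does not increase the updating player's own cost, i.e., J i_m θ^{m+1} ≤ J i_m θ^m, and (iii) for every m the set {J i_m (Function.update θ^m i_m x') | x' ∈ Θ_{i_m}(θ^m)} is bounded below, so the pre-update regrets r_{i_m}(θ^m) are well defined. Then limsup_{m → ∞} r_{i_m}(θ^m) ≤ ε̄; in particular, for every η > 0 the pre-update regret r_{i_m}(θ^m) exceeds ε̄ + η for only finitely many m. -/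
open Filter Topology in
/-- A nonnegative sequence dominated by a constant plus the decrements of an antitone sequence
that is bounded below has limsup at most that constant, and exceeds it by any fixed margin only
finitely often. -/
theorem limsup_le_and_finite_of_le_add_decrement {a r : ℕ → ℝ} {c : ℝ}
    (ha : Antitone a) (hbdd : BddBelow (Set.range a)) (hr0 : ∀ m, 0 ≤ r m)
    (hr : ∀ m, r m ≤ c + (a m - a (m + 1))) :
    limsup r atTop ≤ c ∧ ∀ η > (0 : ℝ), {m : ℕ | c + η < r m}.Finite := by
  have hlim := tendsto_atTop_ciInf ha hbdd
  have hu : Tendsto (fun m => c + (a m - a (m + 1))) atTop (𝓝 c) := by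
    simpa using (hlim.sub (hlim.comp (tendsto_add_atTop_nat 1))).const_add c
  refine ⟨?_, fun η hη => ?_⟩
  · rw [← hu.limsup_eq]
    exact limsup_le_limsup (Eventually.of_forall hr)
      (isCoboundedUnder_le_of_le atTop hr0) hu.isBoundedUnder_le
  · have hev : ∀ᶠ m in cofinite, c + (a m - a (m + 1)) < c + η := by
      rw [Nat.cofinite_eq_atTop]
      exact hu.eventually_lt_const (lt_add_of_pos_right c hη)
    exact (eventually_cofinite.mp hev).subset
      fun m hm => not_lt.mpr ((le_of_lt hm).trans (hr m))

/-- ε̄-equilibrium under inexact iterative best response (Theorem 1): along a sequence of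
ε̄-approximate best-response updates that never increase the updating player's own cost,
with the potential bounded below on `Θ` and each pre-update deviation cost set bounded
below, the pre-update regrets satisfy `limsup r_{i_m}(θ^m) ≤ ε̄`; in particular, for every
`η > 0` only finitely many pre-update regrets exceed `ε̄ + η`. -/
theorem epsbar_equilibrium_inexact_IBR
    {ι : Type*} [DecidableEq ι] {α : ι → Type*}
    (Θ : Set (∀ i, α i)) (J : ι → (∀ i, α i) → ℝ) (Φ : (∀ i, α i) → ℝ)
    (hΦ : ∀ i : ι, ∀ θ ∈ Θ, ∀ θ' ∈ Θ,
      (∀ j, j ≠ i → θ' j = θ j) → J i θ' - J i θ = Φ θ' - Φ θ)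
    (hΦbdd : BddBelow (Φ '' Θ))
    (εbar : ℝ) (hεbar : 0 ≤ εbar)
    (θ : ℕ → ∀ i, α i) (hθ : ∀ m, θ m ∈ Θ)
    (iSeq : ℕ → ι) (xSeq : ∀ m, α (iSeq m))
    (hfeas : ∀ m, Function.update (θ m) (iSeq m) (xSeq m) ∈ Θ)
    (hupd : ∀ m, θ (m + 1) = Function.update (θ m) (iSeq m) (xSeq m))
    (habr : ∀ m, ∀ x' : α (iSeq m), Function.update (θ m) (iSeq m) x' ∈ Θ →
      J (iSeq m) (Function.update (θ m) (iSeq m) (xSeq m)) ≤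
        J (iSeq m) (Function.update (θ m) (iSeq m) x') + εbar)
    (hmono : ∀ m, J (iSeq m) (θ (m + 1)) ≤ J (iSeq m) (θ m))
    (hbdd : ∀ m, BddBelow ((fun x' : α (iSeq m) =>
      J (iSeq m) (Function.update (θ m) (iSeq m) x')) ''
      {x' : α (iSeq m) | Function.update (θ m) (iSeq m) x' ∈ Θ})) :
    Filter.limsup (fun m =>
        J (iSeq m) (θ m) -
          sInf ((fun x' : α (iSeq m) =>
              J (iSeq m) (Function.update (θ m) (iSeq m) x')) ''
            {x' : α (iSeq m) | Function.update (θ m) (iSeq m) x' ∈ Θ}))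
        Filter.atTop ≤ εbar ∧
      ∀ η > (0 : ℝ),
        {m : ℕ | εbar + η <
          J (iSeq m) (θ m) -
            sInf ((fun x' : α (iSeq m) =>
                J (iSeq m) (Function.update (θ m) (iSeq m) x')) ''
              {x' : α (iSeq m) | Function.update (θ m) (iSeq m) x' ∈ Θ})}.Finite := by
  have hstep : ∀ m, J (iSeq m) (θ (m + 1)) - J (iSeq m) (θ m) = Φ (θ (m + 1)) - Φ (θ m) := by
    refine fun m => hΦ (iSeq m) _ (hθ m) _ (hθ (m + 1)) fun j hj => ?_
    rw [hupd m, Function.update_of_ne hj]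
  refine limsup_le_and_finite_of_le_add_decrement (a := fun m => Φ (θ m))
    (antitone_nat_of_succ_le fun m => ?_) (hΦbdd.mono ?_) (fun m => ?_) (fun m => ?_)
  · linarith [hstep m, hmono m]
  · rintro _ ⟨m, rfl⟩
    exact ⟨θ m, hθ m, rfl⟩
  · exact sub_nonneg.mpr (csInf_le (hbdd m) ⟨θ m (iSeq m), by simpa using hθ m, by simp⟩)
  · have hinf : J (iSeq m) (θ (m + 1)) - εbar ≤
        sInf ((fun x' : α (iSeq m) => J (iSeq m) (Function.update (θ m) (iSeq m) x')) ''
          {x' : α (iSeq m) | Function.update (θ m) (iSeq m) x' ∈ Θ}) := by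
      refine le_csInf ⟨_, xSeq m, hfeas m, rfl⟩ ?_
      rintro _ ⟨x', hx', rfl⟩
      rw [hupd m]
      exact sub_le_iff_le_add.mpr (habr m x' hx')
    linarith [hstep m]
end
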